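/- For each m ∈ ℕ there is a constant C_m ≥ 0 such that |⟨φ_m, D_s φ₀⟩| ≤ C_m · |⟨φ₀, D_s φ₀⟩| = C_m/√(cosh s) uniformly in s ∈ ℝ, and C_m = 0 when m is odd. -/

import Mathlib

open MeasureTheory

/-- The semiclassical raising operator `a* = (x - ℏ d/dx)/√(2ℏ)`. -/
noncomputable def araise (ℏ : ℝ) (u : ℝ → ℝ) (x : ℝ) : ℝ :=
  (x * u x - ℏ * deriv u x) / Real.sqrt (2 * ℏ)

/-- The normalized ground state Gaussian `φ₀(x) = (πℏ)^{-1/4} e^{-x²/(2ℏ)}`. -/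
noncomputable def ground (ℏ : ℝ) (x : ℝ) : ℝ :=
  (Real.pi * ℏ) ^ (-(1/4 : ℝ)) * Real.exp (-x ^ 2 / (2 * ℏ))

/-- The `m`-th normalized Hermite function `φ_m = (a*)^m φ₀ / √(m!)`. -/
noncomputable def hermiteFun (ℏ : ℝ) (m : ℕ) (x : ℝ) : ℝ :=
  ((araise ℏ)^[m] (ground ℏ)) x / Real.sqrt (Nat.factorial m)

lemma aux_poly (ℏ : ℝ) (hℏ : 0 < ℏ) (m : ℕ) :
    ∃ p : Polynomial ℝ, ∀ x, ((araise ℏ)^[m] (ground ℏ)) x = p.eval x * ground ℏ x := by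
  induction m with
  | zero => exact ⟨1, fun x => by simp⟩
  | succ n ih =>
    obtain ⟨p, hp⟩ := ih
    refine ⟨Polynomial.C (1 / Real.sqrt (2 * ℏ)) *
      (2 * Polynomial.X * p - Polynomial.C ℏ * Polynomial.derivative p), fun x => ?_⟩
    rw [Function.iterate_succ_apply']
    have hf : (araise ℏ)^[n] (ground ℏ) = fun x => p.eval x * ground ℏ x := funext hp
    rw [hf]
    have hg : HasDerivAt (ground ℏ) (-(x / ℏ) * ground ℏ x) x := by
      have h1 : HasDerivAt (fun x : ℝ => -x ^ 2 / (2 * ℏ)) (-(x / ℏ)) x := by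
        have := ((hasDerivAt_pow 2 x).neg).div_const (2 * ℏ)
        refine this.congr_deriv ?_
        push_cast
        field_simp
      have h2 := (h1.exp).const_mul ((Real.pi * ℏ) ^ (-(1/4 : ℝ)))
      refine HasDerivAt.congr_deriv (f := ground ℏ) h2 ?_
      simp only [ground]; ring
    have hd := ((p.hasDerivAt x).mul hg).deriv
    have hd' : deriv (fun x => p.eval x * ground ℏ x) x = _ := hd
    simp only [araise]
    rw [hd']
    simp
    field_simp
    ring

lemma aux_parity (ℏ : ℝ) (m : ℕ) (x : ℝ) :
    ((araise ℏ)^[m] (ground ℏ)) (-x) = (-1) ^ m * ((araise ℏ)^[m] (ground ℏ)) x := by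
  induction m generalizing x with
  | zero => simp [ground]
  | succ n ih =>
    rw [Function.iterate_succ_apply']
    set u := (araise ℏ)^[n] (ground ℏ)
    have h1 : deriv (fun y => u (-y)) x = - deriv u (-x) := deriv_comp_neg u x
    have h2 : (fun y => u (-y)) = fun y => (-1) ^ n * u y := funext ih
    rw [h2, deriv_const_mul_field] at h1
    have h3 : deriv u (-x) = - ((-1) ^ n * deriv u x) := by linarith
    simp only [araise, ih, h3]
    ring

lemma aux_int (b : ℝ) (hb : 0 < b) (k : ℕ) :
    Integrable (fun x : ℝ => |x| ^ k * Real.exp (-b * x ^ 2)) := by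
  have h := (integrable_rpow_mul_exp_neg_mul_sq hb (s := k)
    (by have : (0:ℝ) ≤ k := k.cast_nonneg
        linarith)).norm
  refine h.congr (Filter.Eventually.of_forall fun x => ?_)
  simp

/-- For each `m` there is `C_m ≥ 0` with
`|⟨φ_m, D_s φ₀⟩| ≤ C_m |⟨φ₀, D_s φ₀⟩| = C_m/√(cosh s)` uniformly in `s ∈ ℝ`,
where `(D_s u)(x) = e^{-s/2} u(e^{-s} x)`; moreover `C_m = 0` for odd `m`. -/
theorem overlap_excited_dilated_ground (ℏ : ℝ) (hℏ : 0 < ℏ) (m : ℕ) :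
    ∃ C : ℝ, 0 ≤ C ∧ (Odd m → C = 0) ∧ ∀ s : ℝ,
      |∫ x : ℝ, hermiteFun ℏ m x *
          (Real.exp (-s / 2) * ground ℏ (Real.exp (-s) * x))| ≤
        C / Real.sqrt (Real.cosh s) := by
  rcases Nat.even_or_odd m with hm | hm
  swap
  · refine ⟨0, le_rfl, fun _ => rfl, fun s => ?_⟩
    have : (∫ x : ℝ, hermiteFun ℏ m x *
          (Real.exp (-s / 2) * ground ℏ (Real.exp (-s) * x))) = 0 := by
      set f := fun x : ℝ => hermiteFun ℏ m x *
          (Real.exp (-s / 2) * ground ℏ (Real.exp (-s) * x)) with hf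
      have h1 : ∀ x, f (-x) = - f x := by
        intro x
        simp only [hf, hermiteFun, aux_parity, hm.neg_one_pow, ground]
        rw [mul_neg, neg_sq]
        ring
      have h2 := integral_neg_eq_self f volume
      simp only [h1, integral_neg] at h2
      linarith
    rw [this]; simp
  obtain ⟨p, hp⟩ := aux_poly ℏ hℏ m
  set K : ℝ := (Real.pi * ℏ) ^ (-(1/4 : ℝ)) with hK
  have hK0 : 0 ≤ K := by positivity
  set b : ℝ := 1 / (2 * ℏ) with hb
  have hb0 : 0 < b := by positivity
  set F : ℝ := Real.sqrt (Nat.factorial m) with hF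
  have hF0 : 0 ≤ F := Real.sqrt_nonneg _
  let G : ℝ → ℝ := fun y => ∑ k ∈ Finset.range (p.natDegree + 1),
    |p.coeff k| * (|y| ^ k * Real.exp (-b * y ^ 2))
  have hG : Integrable G :=
    integrable_finsetSum _ fun k _ => (aux_int b hb0 k).const_mul _
  have hG0 : 0 ≤ ∫ y, G y := integral_nonneg fun y => by
    simp only [G]; positivity
  refine ⟨K * K / F * (∫ y, G y) / Real.sqrt 2, by positivity,
    fun h => absurd hm (Nat.not_even_iff_odd.mpr h), fun s => ?_⟩
  set t : ℝ := Real.sqrt (1 + Real.exp (-s) ^ 2) with ht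
  have ht2 : t ^ 2 = 1 + Real.exp (-s) ^ 2 := Real.sq_sqrt (by positivity)
  have ht0 : 0 < t := Real.sqrt_pos.mpr (by positivity)
  have ht1 : 1 ≤ t := Real.one_le_sqrt.mpr (by nlinarith [sq_nonneg (Real.exp (-s))])
  have hint : Integrable (fun x => K * K / F * Real.exp (-s / 2) * G (t * x)) :=
    (hG.comp_mul_left' ht0.ne').const_mul _
  have hle := norm_integral_le_of_norm_le (μ := volume)
    (f := fun x : ℝ => hermiteFun ℏ m x *
          (Real.exp (-s / 2) * ground ℏ (Real.exp (-s) * x))) hint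
    (Filter.Eventually.of_forall fun x => by
      have e1 : hermiteFun ℏ m x * (Real.exp (-s / 2) * ground ℏ (Real.exp (-s) * x))
          = K * K / F * Real.exp (-s / 2) * (p.eval x * Real.exp (-b * (t * x) ^ 2)) := by
        have e2 : Real.exp (-b * (t * x) ^ 2) = Real.exp (-x ^ 2 / (2 * ℏ)) *
            Real.exp (-(Real.exp (-s) * x) ^ 2 / (2 * ℏ)) := by
          rw [← Real.exp_add, mul_pow, ht2, hb]
          congr 1
          ring
        rw [e2]
        simp only [hermiteFun, hp, ground]
        ring
      rw [e1, norm_mul, Real.norm_of_nonneg (by positivity)]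
      refine mul_le_mul_of_nonneg_left ?_ (by positivity)
      rw [norm_mul, Real.norm_of_nonneg (Real.exp_pos _).le, Polynomial.eval_eq_sum_range]
      simp only [G, ← mul_assoc, ← Finset.sum_mul]
      refine mul_le_mul_of_nonneg_right ?_ (Real.exp_pos _).le
      refine (norm_sum_le _ _).trans (Finset.sum_le_sum fun k _ => ?_)
      rw [norm_mul, norm_pow, Real.norm_eq_abs, Real.norm_eq_abs]
      refine mul_le_mul_of_nonneg_left (pow_le_pow_left₀ (abs_nonneg x) ?_ k) (abs_nonneg _)
      rw [abs_mul, abs_of_pos ht0]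
      exact le_mul_of_one_le_left (abs_nonneg x) ht1)
  rw [Real.norm_eq_abs] at hle
  refine hle.trans (le_of_eq ?_)
  rw [integral_const_mul, Measure.integral_comp_mul_left, abs_of_pos (inv_pos.mpr ht0), smul_eq_mul]
  have key : Real.exp (-s / 2) * t⁻¹ = 1 / (Real.sqrt 2 * Real.sqrt (Real.cosh s)) := by
    have hc := Real.cosh_pos s
    rw [← Real.sqrt_mul (by norm_num), ← div_eq_mul_inv, div_eq_div_iff ht0.ne' (by positivity),
      one_mul]
    have : Real.exp (-s / 2) = Real.sqrt (Real.exp (-s)) := by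
      rw [Real.exp_half]
    rw [this, ← Real.sqrt_mul (Real.exp_pos _).le, ht, Real.cosh_eq]
    congr 1
    have : Real.exp (-s) * Real.exp s = 1 := by rw [← Real.exp_add]; simp
    linear_combination this
  calc _ = K * K / F * (∫ y, G y) * (Real.exp (-s / 2) * t⁻¹) := by ring
    _ = _ := by rw [key]; field_simp
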